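/- Suppose P(0 ∈ C_∞) > 0. There exists a function χ : Ω × Z^d → R^d such that P_0-a.s.: (1) χ(ω,0) = 0 and for all x,y ∈ C_∞(ω), χ(ω,x) − χ(ω,y) = χ(τ_y ω, x − y); (2) the function φ_ω(x) := x + χ(ω,x) satisfies L_ω φ_ω = 0, where (L_ω f)(x) := (2d)^{-1} Σ_{y:|y−x|=1} ω_{xy}[f(y) − f(x)]; and (3) for every α > 0 with P(0 ∈ C_{∞,α}) > 0 there is C = C(α) < ∞ such that for all neighbors x,y ∈ Z^d, E_α( |χ(·,y) − χ(·,x)|² ω_{xy} 1{x∈C_∞} ) < C. -/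

import Mathlib

open MeasureTheory ProbabilityTheory Filter Topology
open scoped ENNReal NNReal BigOperators
open scoped Classical

noncomputable section
namespace RCRW

/-- Sites of the lattice `ℤ^d`. -/
abbrev Site (d : ℕ) := Fin d → ℤ

/-- Nearest-neighbour edges of `ℤ^d`, encoded by their base point and direction. -/
abbrev Edge (d : ℕ) := (Fin d → ℤ) × Fin d

/-- Environments: an assignment of a conductance to every edge. -/
abbrev Env (d : ℕ) := Edge d → ℝ

/-- Euclidean space `ℝ^d`. -/
abbrev Euc (d : ℕ) := EuclideanSpace ℝ (Fin d)

/-- The `i`-th coordinate unit vector of `ℤ^d`. -/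
def unitE (d : ℕ) (i : Fin d) : Site d := fun j => if j = i then 1 else 0

/-- Canonical embedding `ℤ^d → ℝ^d`. -/
def emb (d : ℕ) (x : Site d) : Euc d := (EuclideanSpace.equiv (Fin d) ℝ).symm fun i => (x i : ℝ)

/-- `x` and `y` are nearest neighbours in `ℤ^d`. -/
def adjacent (d : ℕ) (x y : Site d) : Prop :=
  (∃ i, y = x + unitE d i) ∨ (∃ i, x = y + unitE d i)

/-- The conductance of the (unordered) edge between `x` and `y` (zero if not an edge). -/
def condOf (d : ℕ) (ω : Env d) (x y : Site d) : ℝ :=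
  if h : ∃ i, y = x + unitE d i then ω (x, h.choose)
  else if h2 : ∃ i, x = y + unitE d i then ω (y, h2.choose)
  else 0

/-- The shift of the environment by a lattice vector `z`. -/
def shiftBy (d : ℕ) (z : Site d) (ω : Env d) : Env d := fun e => ω (e.1 + z, e.2)

/-- Two sites are linked by an edge of positive conductance. -/
def openRel (d : ℕ) (ω : Env d) (a b : Site d) : Prop :=
  adjacent d a b ∧ 0 < condOf d ω a b

/-- Two sites are linked by an edge of conductance at least `α`. -/
def geRel (d : ℕ) (ω : Env d) (α : ℝ) (a b : Site d) : Prop :=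
  adjacent d a b ∧ α ≤ condOf d ω a b

/-- The infinite cluster `C∞` of edges with positive conductance: the set of sites whose
open-cluster is infinite. -/
def Cinf (d : ℕ) (ω : Env d) : Set (Site d) :=
  {x | {y | Relation.ReflTransGen (openRel d ω) x y}.Infinite}

/-- `C∞,α`: the set of sites connected to infinity by edges of conductance `≥ α`. -/
def Cinfa (d : ℕ) (ω : Env d) (α : ℝ) : Set (Site d) :=
  {x | {y | Relation.ReflTransGen (geRel d ω α) x y}.Infinite}

/-- `P` is the law of i.i.d. random variables indexed by `ι` with one-coordinate marginal `μ`. -/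
def IsIIDLaw {ι : Type*} (P : Measure (ι → ℝ)) (μ : Measure ℝ) : Prop :=
  IsProbabilityMeasure P ∧
    ∀ (s : Finset ι) (f : ι → Set ℝ), (∀ i, MeasurableSet (f i)) →
      P {ω | ∀ i ∈ s, ω i ∈ f i} = ∏ i ∈ s, μ (f i)

/-- The Bernoulli measure on `ℝ` with mass `p` at `1` and `1 - p` at `0`. -/
def bern (p : ℝ) : Measure ℝ :=
  ENNReal.ofReal p • Measure.dirac 1 + ENNReal.ofReal (1 - p) • Measure.dirac 0

/-- The bond-percolation threshold `p_c(d)` of `ℤ^d`. -/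
def pc (d : ℕ) : ℝ :=
  sInf {p : ℝ | 0 ≤ p ∧ p ≤ 1 ∧
    ∀ P : Measure (Env d), IsIIDLaw P (bern p) → 0 < P {ω | (0 : Site d) ∈ Cinf d ω}}

/-- Total conductance emanating from `x`. -/
def degSum (d : ℕ) (ω : Env d) (x : Site d) : ℝ :=
  ∑ i : Fin d, (condOf d ω x (x + unitE d i) + condOf d ω x (x - unitE d i))

/-- One-step transition probabilities of the (lazy) random walk among conductances. -/
def stepProb (d : ℕ) (ω : Env d) (x y : Site d) : ℝ :=
  if adjacent d x y then condOf d ω x y / (2 * d)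
  else if y = x then 1 - degSum d ω x / (2 * d)
  else 0

/-- `Pz` is the quenched path law `P_{ω,z}` of the walk among the conductances `ω`
started at `z`, characterized through its cylinder probabilities. -/
def IsQuenchedLaw (d : ℕ) (ω : Env d) (z : Site d) (Pz : Measure (ℕ → Site d)) : Prop :=
  IsProbabilityMeasure Pz ∧
    ∀ (n : ℕ) (γ : ℕ → Site d),
      Pz {X | ∀ k ≤ n, X k = γ k} =
        ENNReal.ofReal ((if γ 0 = z then (1 : ℝ) else 0) *
          ∏ k ∈ Finset.range n, stepProb d ω (γ k) (γ (k + 1)))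

/-- `ω̂_{xy} = P_{ω,x}(X_{T₁} = y)`: the probability that the walk started at `x` enters
`C∞,α` for the first time (after time `0`) at the site `y`; written as a sum over paths. -/
def hatStep (d : ℕ) (ω : Env d) (α : ℝ) (x y : Site d) : ℝ :=
  ∑' n : ℕ, ∑' γ : Fin (n + 2) → Site d,
    if γ 0 = x ∧ γ (Fin.last (n + 1)) = y ∧ y ∈ Cinfa d ω α ∧
        (∀ k : Fin (n + 2), k ≠ 0 → k ≠ Fin.last (n + 1) → γ k ∉ Cinfa d ω α)
    then ∏ k : Fin (n + 1), stepProb d ω (γ k.castSucc) (γ k.succ)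
    else 0

/-- `n`-step kernel of the induced walk on `C∞,α`. -/
def hatPow (d : ℕ) (ω : Env d) (α : ℝ) : ℕ → Site d → Site d → ℝ
  | 0 => fun x y => if x = y then 1 else 0
  | n + 1 => fun x y => ∑' z : Site d, hatPow d ω α n x z * hatStep d ω α z y

/-- `P_{ω,x}(Y_t = y)` for the continuous-time random walk `Y` on `C∞,α` with
generator `L_ω^{(α)}` (rate-one jumps with kernel `ω̂`). -/
def ctKernel (d : ℕ) (ω : Env d) (α : ℝ) (t : ℝ) (x y : Site d) : ℝ :=
  ∑' n : ℕ, (Real.exp (-t) * t ^ n / n.factorial) * hatPow d ω α n x y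

/-- `E_{ω,x}|Y_t - x|`: expected (Euclidean) displacement of the continuous-time walk. -/
def expDist (d : ℕ) (ω : Env d) (α : ℝ) (t : ℝ) (x : Site d) : ℝ :=
  ∑' y : Site d, ctKernel d ω α t x y * ‖emb d y - emb d x‖

/-- The generator `L_ω^{(α)}` acting on vector-valued functions. -/
def genLa (d : ℕ) (ω : Env d) (α : ℝ) (f : Site d → Euc d) (x : Site d) : Euc d :=
  ∑' y : Site d, hatStep d ω α x y • (f y - f x)

/-- The generator `L_ω` of the walk among conductances on `ℤ^d`, acting on
vector-valued functions. -/
def latOp (d : ℕ) (ω : Env d) (f : Site d → Euc d) (x : Site d) : Euc d :=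
  (2 * (d : ℝ))⁻¹ • ∑ i : Fin d,
    (condOf d ω x (x + unitE d i) • (f (x + unitE d i) - f x) +
      condOf d ω x (x - unitE d i) • (f (x - unitE d i) - f x))

/-- `max_{x ∈ C∞,α, |x| ≤ n} |ψ(x)|`. -/
def maxPsi (d : ℕ) (ω : Env d) (α : ℝ) (ψ : Site d → Euc d) (n : ℝ) : ℝ :=
  sSup ((fun x => ‖ψ x‖) '' {x : Site d | x ∈ Cinfa d ω α ∧ ‖emb d x‖ ≤ n})

/-- The number of sites `x ∈ C∞,α` with `|x| ≤ n` at which `|ψ(x)| ≥ ε n`. -/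
def badCount (d : ℕ) (ω : Env d) (α : ℝ) (ψ : Site d → Euc d) (ε : ℝ) (n : ℕ) : ℕ :=
  Nat.card {x : Site d // x ∈ Cinfa d ω α ∧ ‖emb d x‖ ≤ n ∧ ε * n ≤ ‖ψ x‖}

/-- Lengths of paths from `x` to `y` using only edges of conductance `≥ α`
(graph distance on `C∞,α` is the least element of this set). -/
def gdSet (d : ℕ) (ω : Env d) (α : ℝ) (x y : Site d) : Set ℕ :=
  {n | ∃ γ : Fin (n + 1) → Site d, γ 0 = x ∧ γ (Fin.last n) = y ∧
    ∀ k : Fin n, geRel d ω α (γ k.castSucc) (γ k.succ)}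

/-- The graph distance on `C∞,α` (with value `∞` if there is no path). -/
def gdA (d : ℕ) (ω : Env d) (α : ℝ) (x y : Site d) : ℝ≥0∞ :=
  sInf ((fun n : ℕ => (n : ℝ≥0∞)) '' gdSet d ω α x y)

/-- Lengths of "jump paths" available to the walk `Y` on `C∞,α`: consecutive points are
linked by a jump of positive probability `ω̂ > 0`.  The jump distance `d(x,y)` of the
walk `Y` is the least element of this set. -/
def jumpDistSet (d : ℕ) (ω : Env d) (α : ℝ) (x y : Site d) : Set ℕ :=
  {n | ∃ γ : Fin (n + 1) → Site d, γ 0 = x ∧ γ (Fin.last n) = y ∧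
    ∀ k : Fin n, 0 < hatStep d ω α (γ k.castSucc) (γ k.succ)}

/-- The relation defining the components of `C∞ \ C∞,α`. -/
def weakRel (d : ℕ) (ω : Env d) (α : ℝ) (a b : Site d) : Prop :=
  adjacent d a b ∧ 0 < condOf d ω a b ∧
    a ∈ Cinf d ω \ Cinfa d ω α ∧ b ∈ Cinf d ω \ Cinfa d ω α

/-- `F(x)`: the connected component of `C∞ \ C∞,α` containing `x` (empty if
`x ∉ C∞ \ C∞,α`). -/
def Fcomp (d : ℕ) (ω : Env d) (α : ℝ) (x : Site d) : Set (Site d) :=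
  {y | x ∈ Cinf d ω \ Cinfa d ω α ∧ Relation.ReflTransGen (weakRel d ω α) x y}

/-- The `ℓ^∞` distance on `ℤ^d` (as a natural number). -/
def linfDist (d : ℕ) (x y : Site d) : ℕ :=
  Finset.univ.sup fun i => (x i - y i).natAbs


/-- The defining properties of the corrector `χ` (Theorem 3.1(1-3)):
`P_0`-a.s. it vanishes at the origin, is a shift-covariant gradient field on `C∞`,
makes `x + χ(ω,x)` harmonic for `L_ω`, and it has the square-integrability property
w.r.t. every conditional law `P_α`. -/
def IsCorrector (d : ℕ) (P : Measure (Env d)) (χ : Env d → Site d → Euc d) : Prop :=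
  (∀ᵐ ω ∂(ProbabilityTheory.cond P {ω' | (0 : Site d) ∈ Cinf d ω'}),
    χ ω 0 = 0 ∧
    (∀ x ∈ Cinf d ω, ∀ y ∈ Cinf d ω, χ ω x - χ ω y = χ (shiftBy d y ω) (x - y)) ∧
    (∀ x ∈ Cinf d ω, latOp d ω (fun z => emb d z + χ ω z) x = 0)) ∧
  (∀ α : ℝ, 0 < α → 0 < P {ω | (0 : Site d) ∈ Cinfa d ω α} →
    ∃ C : ℝ, ∀ x y : Site d, adjacent d x y →
      ∫ ω, ‖χ ω y - χ ω x‖ ^ 2 * condOf d ω x y *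
          Set.indicator {ω' : Env d | x ∈ Cinf d ω'} (fun _ => (1 : ℝ)) ω
        ∂(ProbabilityTheory.cond P {ω' | (0 : Site d) ∈ Cinfa d ω' α}) < C)

section Shift

variable {d : ℕ}

lemma measurable_shiftBy (z : Site d) : Measurable (shiftBy d z) :=
  measurable_pi_lambda _ fun _ => measurable_pi_apply _

lemma shiftBy_shiftBy (y z : Site d) (ω : Env d) :
    shiftBy d y (shiftBy d z ω) = shiftBy d (y + z) ω := by
  ext e
  simp [shiftBy, add_assoc]

@[simp] lemma shiftBy_zero (ω : Env d) : shiftBy d 0 ω = ω := by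
  ext e
  simp [shiftBy]

lemma IsIIDLaw.eq_infinitePi {ι : Type*} {P : Measure (ι → ℝ)} {μ : Measure ℝ}
    [IsProbabilityMeasure μ] (hP : IsIIDLaw P μ) : P = Measure.infinitePi fun _ => μ :=
  Measure.eq_infinitePi _ fun s t ht => by
    rw [← hP.2 s t ht]
    congr 1

lemma IsIIDLaw.measurePreserving_shiftBy {P : Measure (Env d)} {μ : Measure ℝ}
    [IsProbabilityMeasure μ] (hP : IsIIDLaw P μ) (z : Site d) :
    MeasurePreserving (shiftBy d z) P P := by
  refine ⟨measurable_shiftBy z, ?_⟩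
  have := hP.1
  have hmap : IsIIDLaw (P.map (shiftBy d z)) μ := by
    refine ⟨Measure.isProbabilityMeasure_map (measurable_shiftBy z).aemeasurable, fun s f hf => ?_⟩
    have hset : MeasurableSet {ω : Env d | ∀ i ∈ s, ω i ∈ f i} := by
      have : {ω : Env d | ∀ i ∈ s, ω i ∈ f i} = ⋂ i ∈ s, (fun ω => ω i) ⁻¹' f i := by
        ext; simp
      rw [this]
      exact s.measurableSet_biInter fun i _ => measurable_pi_apply i (hf i)
    rw [Measure.map_apply (measurable_shiftBy z) hset]
    let e : Edge d ↪ Edge d := ⟨fun b => (b.1 + z, b.2), fun a b h => by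
      simp only [Prod.mk.injEq, add_left_inj] at h
      exact Prod.ext h.1 h.2⟩
    have h := hP.2 (s.map e) (fun b => f (b.1 - z, b.2)) fun _ => hf _
    have he (b) : e b = (b.1 + z, b.2) := rfl
    simp only [Finset.forall_mem_map, Finset.prod_map, he, add_sub_cancel_right] at h
    exact h
  rw [hmap.eq_infinitePi, ← hP.eq_infinitePi]

lemma IsIIDLaw.ae_mem_Icc {P : Measure (Env d)} {μ : Measure ℝ} (hP : IsIIDLaw P μ)
    (hsupp : μ (Set.Icc (0 : ℝ) 1)ᶜ = 0) : ∀ᵐ ω ∂P, ∀ e, ω e ∈ Set.Icc (0 : ℝ) 1 := by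
  refine ae_all_iff.2 fun e => ?_
  have h := hP.2 {e} (fun _ => (Set.Icc (0 : ℝ) 1)ᶜ) fun _ => measurableSet_Icc.compl
  simp only [Finset.mem_singleton, forall_eq, Finset.prod_singleton, hsupp] at h
  exact h

lemma unitE_injective : Function.Injective (unitE d) := fun i j h => by
  by_contra hne
  simpa [unitE, hne] using congrFun h i

lemma condOf_add_unitE (ω : Env d) (x : Site d) (i : Fin d) :
    condOf d ω x (x + unitE d i) = ω (x, i) := by
  have h : ∃ j, x + unitE d i = x + unitE d j := ⟨i, rfl⟩
  have hi : h.choose = i := (unitE_injective (add_left_cancel h.choose_spec)).symm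
  rw [condOf, dif_pos h, hi]

lemma condOf_add_unitE_left (ω : Env d) (x : Site d) (i : Fin d) :
    condOf d ω (x + unitE d i) x = ω (x, i) := by
  have h : ∃ j, x + unitE d i = x + unitE d j := ⟨i, rfl⟩
  have hi : h.choose = i := (unitE_injective (add_left_cancel h.choose_spec)).symm
  have hno : ¬ ∃ j, x = x + unitE d i + unitE d j := by
    rintro ⟨j, hj⟩
    have := congrFun hj i
    simp only [unitE, Pi.add_apply, if_true] at this
    split_ifs at this <;> omega
  rw [condOf, dif_neg hno, dif_pos h, hi]

lemma condOf_sub_unitE (ω : Env d) (x : Site d) (i : Fin d) :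
    condOf d ω x (x - unitE d i) = ω (x - unitE d i, i) := by
  simpa using condOf_add_unitE_left ω (x - unitE d i) i

end Shift

/-- The limit of real sequences extends to a linear functional on all sequences. -/
lemma exists_linear_limit :
    ∃ Λ : (ℕ → ℝ) →ₗ[ℝ] ℝ, ∀ f a, Tendsto f atTop (𝓝 a) → Λ f = a := by
  let S : Submodule ℝ (ℕ → ℝ) :=
    { carrier := {f | ∃ a, Tendsto f atTop (𝓝 a)}
      add_mem' := fun ⟨a, ha⟩ ⟨b, hb⟩ => ⟨a + b, ha.add hb⟩
      zero_mem' := ⟨0, tendsto_const_nhds⟩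
      smul_mem' := fun c _ ⟨a, ha⟩ => ⟨c * a, ha.const_mul c⟩ }
  have hlim (f : S) : Tendsto f.1 atTop (𝓝 f.2.choose) := f.2.choose_spec
  let L : S →ₗ[ℝ] ℝ :=
    { toFun := fun f => f.2.choose
      map_add' := fun f g => tendsto_nhds_unique (hlim (f + g)) ((hlim f).add (hlim g))
      map_smul' := fun c f => tendsto_nhds_unique (hlim (c • f)) ((hlim f).const_mul c) }
  obtain ⟨Λ, hΛ⟩ := L.exists_extend
  refine ⟨Λ, fun f a hf => ?_⟩
  have h : Λ f = L ⟨f, a, hf⟩ := LinearMap.congr_fun hΛ ⟨f, a, hf⟩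
  exact h.trans (tendsto_nhds_unique (hlim ⟨f, a, hf⟩) hf)

/-- A vector can be corrected inside the closure of a subspace so as to become orthogonal to that
subspace. -/
lemma exists_mem_closure_inner_add_eq_zero {H : Type*} [NormedAddCommGroup H]
    [InnerProductSpace ℝ H] [CompleteSpace H] (S : Submodule ℝ H) (u : H) :
    ∃ p ∈ S.topologicalClosure, ∀ s ∈ S, inner ℝ (u + p) s = 0 := by
  have : CompleteSpace S.topologicalClosure :=
    S.isClosed_topologicalClosure.completeSpace_coe
  refine ⟨-S.topologicalClosure.starProjection u,
    neg_mem (Submodule.starProjection_apply_mem _ _), fun s hs => ?_⟩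
  rw [← sub_eq_add_neg]
  exact Submodule.starProjection_inner_eq_zero _ _ (S.le_topologicalClosure hs)

section Gradient

variable {d : ℕ}

/-- The gradient, along the edges at the origin, of the random field `z ↦ ψ (τ_z ω)`. -/
def shiftGrad (ψ : Env d → ℝ) (q : Env d × Fin d) : ℝ :=
  ψ (shiftBy d (unitE d q.2) q.1) - ψ q.1

/-- The conductance, truncated to `[0, 1]`, of an edge at the origin. -/
def edgeWeight (q : Env d × Fin d) : ℝ≥0 := (min 1 (q.1 (0, q.2))).toNNReal

/-- The conductance-weighted measure on pairs of an environment and an edge at the origin. -/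
def edgeMeasure (P : Measure (Env d)) : Measure (Env d × Fin d) :=
  (P.prod Measure.count).withDensity fun q => (edgeWeight q : ℝ≥0∞)

lemma measurable_edgeWeight : Measurable (edgeWeight (d := d)) :=
  measurable_from_prod_countable_left fun i =>
    (measurable_const.min (measurable_pi_apply ((0, i) : Edge d))).real_toNNReal

lemma edgeWeight_le_one (q : Env d × Fin d) : edgeWeight q ≤ 1 := by
  rw [edgeWeight, Real.toNNReal_le_one]
  exact min_le_left _ _

lemma edgeWeight_shiftBy {ω : Env d} (hω : ∀ e, ω e ∈ Set.Icc (0 : ℝ) 1) (x : Site d) (i : Fin d) :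
    (edgeWeight (shiftBy d x ω, i) : ℝ) = ω (x, i) := by
  simp [edgeWeight, shiftBy, (hω _).1, (hω _).2]

lemma measurable_shiftGrad {ψ : Env d → ℝ} (hψ : Measurable ψ) : Measurable (shiftGrad ψ) :=
  measurable_from_prod_countable_left fun i =>
    (hψ.comp (measurable_shiftBy (unitE d i))).sub hψ

instance (P : Measure (Env d)) [IsFiniteMeasure P] : IsFiniteMeasure (edgeMeasure P) := by
  refine isFiniteMeasure_withDensity (ne_top_of_le_ne_top (b := ∫⁻ _, 1 ∂(P.prod Measure.count))
    (by simp) (lintegral_mono fun q => ?_))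
  exact ENNReal.coe_le_one_iff.2 (edgeWeight_le_one q)

lemma lintegral_edgeMeasure (P : Measure (Env d)) [SFinite P] {f : Env d × Fin d → ℝ≥0∞}
    (hf : Measurable f) :
    ∫⁻ q, f q ∂edgeMeasure P = ∑ i, ∫⁻ ω, edgeWeight (ω, i) * f (ω, i) ∂P := by
  have hw : Measurable fun q : Env d × Fin d => (edgeWeight q : ℝ≥0∞) :=
    measurable_edgeWeight.coe_nnreal_ennreal
  rw [edgeMeasure, lintegral_withDensity_eq_lintegral_mul _ hw hf,
    lintegral_prod_symm _ (hw.mul hf).aemeasurable, lintegral_count, tsum_fintype]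
  rfl

lemma integrable_edgeMeasure {P : Measure (Env d)} [SFinite P] {f : Env d × Fin d → ℝ}
    (hf : Integrable f (edgeMeasure P)) (i : Fin d) :
    Integrable (fun ω => (edgeWeight (ω, i) : ℝ) * f (ω, i)) P := by
  have h := (integrable_withDensity_iff_integrable_smul measurable_edgeWeight).1 hf
  have := ((integrable_prod_iff' h.1).1 h).1
  exact Measure.ae_count_iff.1 this i

lemma integral_edgeMeasure {P : Measure (Env d)} [SFinite P] {f : Env d × Fin d → ℝ}
    (hf : Integrable f (edgeMeasure P)) :
    ∫ q, f q ∂edgeMeasure P = ∑ i, ∫ ω, (edgeWeight (ω, i) : ℝ) * f (ω, i) ∂P := by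
  have h := (integrable_withDensity_iff_integrable_smul measurable_edgeWeight).1 hf
  rw [edgeMeasure, integral_withDensity_eq_integral_smul measurable_edgeWeight,
    integral_prod_symm _ h, integral_countable (by simp)]
  simp [tsum_fintype, NNReal.smul_def, Measure.real]

lemma ae_edgeMeasure {P : Measure (Env d)} [SFinite P] {p : Env d × Fin d → Prop}
    (h : ∀ᵐ q ∂edgeMeasure P, p q) : ∀ᵐ ω ∂P, ∀ i, 0 < edgeWeight (ω, i) → p (ω, i) := by
  rw [edgeMeasure, ae_withDensity_iff measurable_edgeWeight.coe_nnreal_ennreal] at h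
  filter_upwards [Measure.ae_ae_of_ae_prod h] with ω hω i hi
  exact Measure.ae_count_iff.1 hω i (by simpa using hi.ne')

lemma memLp_shiftGrad (P : Measure (Env d)) [IsFiniteMeasure P] {ψ : Env d → ℝ}
    (hψ : Measurable ψ) {C : ℝ} (hC : ∀ ω, |ψ ω| ≤ C) : MemLp (shiftGrad ψ) 2 (edgeMeasure P) := by
  refine MemLp.of_bound (measurable_shiftGrad hψ).aestronglyMeasurable (C + C)
    (ae_of_all _ fun q => ?_)
  exact (abs_sub _ _).trans (add_le_add (hC _) (hC _))

/-- The square-integrable gradients of bounded random variables. -/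
def gradSubmodule (P : Measure (Env d)) : Submodule ℝ (Lp ℝ 2 (edgeMeasure P)) where
  carrier := {f | ∃ ψ : Env d → ℝ, Measurable ψ ∧ (∃ C, ∀ ω, |ψ ω| ≤ C) ∧
    f =ᵐ[edgeMeasure P] shiftGrad ψ}
  zero_mem' := ⟨0, measurable_zero, ⟨0, by simp⟩, by
    filter_upwards [Lp.coeFn_zero ℝ 2 (edgeMeasure P)] with q hq
    exact hq.trans (by simp [shiftGrad])⟩
  add_mem' := by
    rintro f g ⟨φ, hφ, ⟨C, hC⟩, hf⟩ ⟨ψ, hψ, ⟨D, hD⟩, hg⟩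
    refine ⟨φ + ψ, hφ.add hψ, ⟨C + D, fun ω => ?_⟩, ?_⟩
    · exact (abs_add_le _ _).trans (add_le_add (hC ω) (hD ω))
    · filter_upwards [Lp.coeFn_add f g, hf, hg] with q hq hf hg
      simp only [hq, Pi.add_apply, hf, hg, shiftGrad]
      ring
  smul_mem' := by
    rintro c f ⟨φ, hφ, ⟨C, hC⟩, hf⟩
    refine ⟨c • φ, hφ.const_smul c, ⟨|c| * C, fun ω => ?_⟩, ?_⟩
    · rw [Pi.smul_apply, smul_eq_mul, abs_mul]
      exact mul_le_mul_of_nonneg_left (hC ω) (abs_nonneg c)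
    · filter_upwards [Lp.coeFn_smul c f, hf] with q hq hf
      simp only [hq, Pi.smul_apply, hf, shiftGrad, smul_eq_mul]
      ring

/-- A flux `f`, weighted by the conductances, that is orthogonal to all gradients of indicators
has zero divergence. -/
lemma ae_divergence_eq_zero {P : Measure (Env d)} [IsFiniteMeasure P]
    (hshift : ∀ z, MeasurePreserving (shiftBy d z) P P) {f : Env d × Fin d → ℝ}
    (hf : MemLp f 2 (edgeMeasure P))
    (horth : ∀ s : Set (Env d), MeasurableSet s →
      ∫ q, f q * shiftGrad (s.indicator 1) q ∂edgeMeasure P = 0) :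
    ∀ᵐ ω ∂P, ∑ i, ((edgeWeight (ω, i) : ℝ) * f (ω, i) -
      edgeWeight (shiftBy d (-unitE d i) ω, i) * f (shiftBy d (-unitE d i) ω, i)) = 0 := by
  set h : Fin d → Env d → ℝ := fun i ω => (edgeWeight (ω, i) : ℝ) * f (ω, i) with hh
  have hint (i) : Integrable (h i) P := integrable_edgeMeasure (hf.integrable one_le_two) i
  have hint' (i) : Integrable (fun ω => h i (shiftBy d (-unitE d i) ω)) P :=
    (hshift _).integrable_comp_of_integrable (hint i)
  have hD : Integrable (fun ω => ∑ i, (h i ω - h i (shiftBy d (-unitE d i) ω))) P :=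
    integrable_finsetSum _ fun i _ => (hint i).sub (hint' i)
  refine hD.ae_eq_zero_of_forall_setIntegral_eq_zero fun s hs _ => ?_
  have hind : Measurable (s.indicator (1 : Env d → ℝ)) := measurable_one.indicator hs
  have hbound (ω) : |s.indicator (1 : Env d → ℝ) ω| ≤ 1 := by
    by_cases hω : ω ∈ s <;> simp [hω]
  have hprod : Integrable (fun q => f q * shiftGrad (s.indicator 1) q) (edgeMeasure P) :=
    hf.integrable_mul (memLp_shiftGrad P hind hbound)
  have key (i) : ∫ ω, (edgeWeight (ω, i) : ℝ) * (f (ω, i) * shiftGrad (s.indicator 1) (ω, i)) ∂P =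
      ∫ ω in s, h i (shiftBy d (-unitE d i) ω) ∂P - ∫ ω in s, h i ω ∂P := by
    have hs' : MeasurableSet (shiftBy d (unitE d i) ⁻¹' s) := measurable_shiftBy _ hs
    have h1 : ∫ ω in s, h i (shiftBy d (-unitE d i) ω) ∂P =
        ∫ ω, (shiftBy d (unitE d i) ⁻¹' s).indicator (h i) ω ∂P := by
      have hmap := integral_map (μ := P) (measurable_shiftBy (-unitE d i)).aemeasurable
        (f := (shiftBy d (unitE d i) ⁻¹' s).indicator (h i))
        ((hshift _).map_eq.symm ▸ (hint i).1.indicator hs')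
      rw [(hshift _).map_eq] at hmap
      rw [hmap, ← integral_indicator hs]
      simp [Set.indicator, shiftBy_shiftBy]
    rw [h1, ← integral_indicator hs, ← integral_sub ((hint i).indicator hs')
      ((hint i).indicator hs)]
    refine integral_congr_ae (ae_of_all _ fun ω => ?_)
    simp only [shiftGrad, Set.indicator, Set.mem_preimage, hh, Pi.one_apply]
    split_ifs <;> ring
  have h0 := horth s hs
  rw [integral_edgeMeasure hprod, Finset.sum_congr rfl fun i _ => key i] at h0
  rw [integral_finsetSum (f := fun i ω => h i ω - h i (shiftBy d (-unitE d i) ω)) _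
      fun i _ => ((hint i).sub (hint' i)).integrableOn,
    Finset.sum_congr rfl fun i _ => integral_sub (hint i).integrableOn (hint' i).integrableOn,
    ← neg_eq_zero, ← Finset.sum_neg_distrib, ← h0]
  simp

/-- The corrector of the vector field `u` at the level of gradients: the limit of gradients of
random variables whose sum with `u` is divergence free. -/
lemma exists_gradient_corrector {P : Measure (Env d)} [IsFiniteMeasure P]
    (hshift : ∀ z, MeasurePreserving (shiftBy d z) P P) (u : Fin d → ℝ) :
    ∃ (ψ : ℕ → Env d → ℝ) (g : Env d × Fin d → ℝ), Measurable g ∧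
      (∫⁻ q, ‖g q‖ₑ ^ 2 ∂edgeMeasure P < ∞) ∧
      (∀ᵐ q ∂edgeMeasure P, Tendsto (fun n => shiftGrad (ψ n) q) atTop (𝓝 (g q))) ∧
      ∀ᵐ ω ∂P, ∑ i, ((edgeWeight (ω, i) : ℝ) * (u i + g (ω, i)) -
        edgeWeight (shiftBy d (-unitE d i) ω, i) *
          (u i + g (shiftBy d (-unitE d i) ω, i))) = 0 := by
  have hu : MemLp (fun q : Env d × Fin d => u q.2) 2 (edgeMeasure P) := by
    refine MemLp.of_bound (measurable_of_countable u |>.comp measurable_snd).aestronglyMeasurable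
      (∑ i, |u i|) (ae_of_all _ fun q => ?_)
    exact Finset.single_le_sum (f := fun i => |u i|) (fun i _ => abs_nonneg _) (Finset.mem_univ _)
  obtain ⟨p, hp, horth⟩ := exists_mem_closure_inner_add_eq_zero (gradSubmodule P) hu.toLp
  obtain ⟨F, hF, hFp⟩ := mem_closure_iff_seq_limit.1
    ((gradSubmodule P).topologicalClosure_coe ▸ hp : p ∈ closure (gradSubmodule P : Set _))
  choose ψ hψ _ hFψ using hF
  obtain ⟨ns, -, hns⟩ := (tendstoInMeasure_of_tendsto_Lp hFp).exists_seq_tendsto_ae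
  refine ⟨fun n => ψ (ns n), p, (Lp.stronglyMeasurable p).measurable, ?_, ?_, ?_⟩
  · have := (Lp.memLp p).eLpNorm_lt_top
    rw [eLpNorm_lt_top_iff_lintegral_rpow_enorm_lt_top (by simp) (by simp)] at this
    simpa using this
  · filter_upwards [hns, ae_all_iff.2 hFψ] with q hq hq'
    simpa [hq'] using hq
  · refine ae_divergence_eq_zero hshift (f := fun q => u q.2 + p q) (hu.add (Lp.memLp p))
      fun s hs => ?_
    have hind : Measurable (s.indicator (1 : Env d → ℝ)) := measurable_one.indicator hs
    have hbound (ω) : |s.indicator (1 : Env d → ℝ) ω| ≤ 1 := by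
      by_cases hω : ω ∈ s <;> simp [hω]
    have hG := memLp_shiftGrad P hind hbound
    have h := horth hG.toLp ⟨_, hind, ⟨1, hbound⟩, hG.coeFn_toLp⟩
    rw [L2.inner_def] at h
    rw [← h]
    refine integral_congr_ae ?_
    filter_upwards [Lp.coeFn_add hu.toLp p, hu.coeFn_toLp, hG.coeFn_toLp] with q h1 h2 h3
    rw [h1, h3, Pi.add_apply, h2]
    exact mul_comm _ _

end Gradient

section Corrector

variable {d : ℕ}

lemma ae_forall_shiftBy {P : Measure (Env d)}
    (hshift : ∀ z, MeasurePreserving (shiftBy d z) P P) {p : Env d → Prop} (h : ∀ᵐ ω ∂P, p ω) :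
    ∀ᵐ ω ∂P, ∀ x, p (shiftBy d x ω) :=
  ae_all_iff.2 fun x => (hshift x).quasiMeasurePreserving.ae h

lemma integral_cond_le {Ω : Type*} [MeasurableSpace Ω] {P : Measure Ω} {A : Set Ω} (hA : P A ≠ 0)
    {K : ℝ≥0∞} (hK : K ≠ ∞) {f : Ω → ℝ} (hf : ∫⁻ ω, ‖f ω‖ₑ ∂P ≤ K) :
    ∫ ω, f ω ∂(cond P A) ≤ ((P A)⁻¹ * K).toReal := by
  have h : ‖∫ ω, f ω ∂(cond P A)‖ₑ ≤ (P A)⁻¹ * K := by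
    refine (enorm_integral_le_lintegral_enorm _).trans ?_
    rw [ProbabilityTheory.cond, lintegral_smul_measure]
    exact mul_le_mul_right ((lintegral_mono' Measure.restrict_le_self le_rfl).trans hf) _
  refine (Real.le_norm_self _).trans ?_
  rw [← toReal_enorm]
  exact ENNReal.toReal_mono (ENNReal.mul_ne_top (ENNReal.inv_ne_top.2 hA) hK) h

lemma enorm_sq_eq_sum (v : Euc d) : ‖v‖ₑ ^ 2 = ∑ k, ‖v k‖ₑ ^ 2 := by
  simp only [enorm_eq_nnnorm]
  norm_cast
  ext
  push_cast
  exact EuclideanSpace.norm_sq_eq v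

lemma emb_apply (x : Site d) (k : Fin d) : emb d x k = (x k : ℝ) := rfl

/-- If the increments of `χ` along open edges are given by `g`, and `g` plus the unit fields has zero
divergence, then `x + χ x` is harmonic. -/
lemma latOp_emb_add_eq_zero {ω : Env d} (hω : ∀ e, ω e ∈ Set.Icc (0 : ℝ) 1) {χ : Site d → Euc d}
    {g : Fin d → Env d × Fin d → ℝ}
    (hgrad : ∀ x i k, 0 < ω (x, i) →
      χ (x + unitE d i) k - χ x k = g k (shiftBy d x ω, i))
    (hdiv : ∀ x k, ∑ i, ((edgeWeight (shiftBy d x ω, i) : ℝ) *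
      ((unitE d i k : ℝ) + g k (shiftBy d x ω, i)) -
      edgeWeight (shiftBy d (-unitE d i) (shiftBy d x ω), i) *
        ((unitE d i k : ℝ) + g k (shiftBy d (-unitE d i) (shiftBy d x ω), i))) = 0)
    (x : Site d) : latOp d ω (fun z => emb d z + χ z) x = 0 := by
  have hflux (y : Site d) (i k : Fin d) :
      ω (y, i) * ((emb d (y + unitE d i) + χ (y + unitE d i)) k - (emb d y + χ y) k) =
        edgeWeight (shiftBy d y ω, i) * ((unitE d i k : ℝ) + g k (shiftBy d y ω, i)) := by
    rw [edgeWeight_shiftBy hω]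
    rcases (hω (y, i)).1.eq_or_lt with h | h
    · simp [← h]
    · rw [← hgrad y i k h]
      simp only [PiLp.add_apply, emb_apply, Pi.add_apply, Int.cast_add]
      ring
  rw [latOp, smul_eq_zero]
  right
  ext k
  rw [WithLp.ofLp_sum, Finset.sum_apply, PiLp.zero_apply, ← hdiv x k]
  refine Finset.sum_congr rfl fun i _ => ?_
  have h1 := hflux x i k
  have h2 := hflux (x - unitE d i) i k
  rw [sub_add_cancel] at h2
  rw [shiftBy_shiftBy, neg_add_eq_sub, ← h1, ← h2, condOf_add_unitE, condOf_sub_unitE]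
  simp only [PiLp.add_apply, PiLp.smul_apply, PiLp.sub_apply, smul_eq_mul]
  ring

lemma lintegral_increment_le {P : Measure (Env d)} [SFinite P]
    (hshift : ∀ z, MeasurePreserving (shiftBy d z) P P)
    (hmem : ∀ᵐ ω ∂P, ∀ e, ω e ∈ Set.Icc (0 : ℝ) 1) {χ : Env d → Site d → Euc d}
    {g : Fin d → Env d × Fin d → ℝ} (hg : ∀ k, Measurable (g k))
    (hgrad : ∀ᵐ ω ∂P, ∀ x i k, 0 < ω (x, i) →
      χ ω (x + unitE d i) k - χ ω x k = g k (shiftBy d x ω, i)) (x : Site d) (i : Fin d) :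
    ∫⁻ ω, ‖χ ω (x + unitE d i) - χ ω x‖ₑ ^ 2 * ‖ω (x, i)‖ₑ ∂P ≤
      ∑ k, ∫⁻ q, ‖g k q‖ₑ ^ 2 ∂edgeMeasure P := by
  have hgm (k) : Measurable fun q => ‖g k q‖ₑ ^ 2 := (hg k).enorm.pow_const 2
  have hF (k) : Measurable fun ω : Env d => (edgeWeight (ω, i) : ℝ≥0∞) * ‖g k (ω, i)‖ₑ ^ 2 :=
    (measurable_edgeWeight.coe_nnreal_ennreal.mul (hgm k)).comp measurable_prodMk_right
  calc ∫⁻ ω, ‖χ ω (x + unitE d i) - χ ω x‖ₑ ^ 2 * ‖ω (x, i)‖ₑ ∂P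
      = ∫⁻ ω, ∑ k, (edgeWeight (shiftBy d x ω, i) : ℝ≥0∞) *
          ‖g k (shiftBy d x ω, i)‖ₑ ^ 2 ∂P := by
        refine lintegral_congr_ae ?_
        filter_upwards [hmem, hgrad] with ω hω hgr
        have hw : (edgeWeight (shiftBy d x ω, i) : ℝ≥0∞) = ‖ω (x, i)‖ₑ := by
          rw [← edgeWeight_shiftBy hω]
          simp
        rw [enorm_sq_eq_sum, Finset.sum_mul]
        refine Finset.sum_congr rfl fun k _ => ?_
        rw [hw, mul_comm]
        rcases (hω (x, i)).1.eq_or_lt with h | h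
        · simp [← h]
        · rw [← hgr x i k h, PiLp.sub_apply]
    _ = ∑ k, ∫⁻ ω, (edgeWeight (ω, i) : ℝ≥0∞) * ‖g k (ω, i)‖ₑ ^ 2 ∂P := by
        rw [lintegral_finsetSum (f := fun k ω => (edgeWeight (shiftBy d x ω, i) : ℝ≥0∞) *
          ‖g k (shiftBy d x ω, i)‖ₑ ^ 2) _ fun k _ => (hF k).comp (measurable_shiftBy x)]
        exact Finset.sum_congr rfl fun k _ => (hshift x).lintegral_comp (hF k)
    _ ≤ ∑ k, ∫⁻ q, ‖g k q‖ₑ ^ 2 ∂edgeMeasure P := by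
        refine Finset.sum_le_sum fun k _ => ?_
        rw [lintegral_edgeMeasure P (hgm k)]
        exact Finset.single_le_sum
          (f := fun i => ∫⁻ ω, (edgeWeight (ω, i) : ℝ≥0∞) * ‖g k (ω, i)‖ₑ ^ 2 ∂P)
          (fun _ _ => zero_le) (Finset.mem_univ i)

end Corrector

/-- **Theorem 3.1(1-3)** (existence of the corrector).  If `P(0 ∈ C∞) > 0` then there is a
function `χ : Ω × ℤ^d → ℝ^d` which `P_0`-a.s. vanishes at `0`, is a shift-covariant
gradient field on `C∞`, makes `φ_ω(x) = x + χ(ω,x)` harmonic for `L_ω`, and which has the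
square-integrability property `E_α(|χ(·,y) - χ(·,x)|² ω_{xy} 1_{x ∈ C∞}) < C(α)` for every
`α > 0` with `P(0 ∈ C∞,α) > 0`. -/
theorem statement4 (d : ℕ) (hd : 2 ≤ d)
    (μ : Measure ℝ) [IsProbabilityMeasure μ] (hsupp : μ (Set.Icc (0 : ℝ) 1)ᶜ = 0)
    (P : Measure (Env d)) (hP : IsIIDLaw P μ)
    (h0 : 0 < P {ω | (0 : Site d) ∈ Cinf d ω}) :
    ∃ χ : Env d → Site d → Euc d, IsCorrector d P χ := by
  have := hP.1
  have hshift := hP.measurePreserving_shiftBy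
  have hmem := hP.ae_mem_Icc hsupp
  choose ψ g hg hgfin hlim hdiv using fun k : Fin d =>
    exists_gradient_corrector hshift fun i => (unitE d i k : ℝ)
  obtain ⟨Λ, hΛ⟩ := exists_linear_limit
  let χ : Env d → Site d → Euc d := fun ω x =>
    WithLp.toLp 2 fun k => Λ fun n => ψ k n (shiftBy d x ω) - ψ k n ω
  have hχ (ω x y) : χ ω x - χ ω y = χ (shiftBy d y ω) (x - y) := by
    ext k
    change Λ _ - Λ _ = Λ _
    rw [← map_sub]
    congr 1
    ext n
    simp [shiftBy_shiftBy]
  have hgrad : ∀ᵐ ω ∂P, ∀ x i k, 0 < ω (x, i) →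
      χ ω (x + unitE d i) k - χ ω x k = g k (shiftBy d x ω, i) := by
    filter_upwards [hmem, ae_forall_shiftBy hshift
      (ae_all_iff.2 fun k => ae_edgeMeasure (hlim k))] with ω hω hlim x i k hpos
    rw [← PiLp.sub_apply, hχ, add_sub_cancel_left]
    refine hΛ _ _ (hlim x k i ?_)
    rw [← NNReal.coe_pos, edgeWeight_shiftBy hω]
    exact hpos
  refine ⟨χ, cond_absolutelyContinuous.ae_le ?_, fun α _ hα => ?_⟩
  · filter_upwards [hmem, hgrad, ae_forall_shiftBy hshift (ae_all_iff.2 hdiv)] with ω hω hgr hdv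
    refine ⟨?_, fun x _ y _ => hχ ω x y, fun x _ => latOp_emb_add_eq_zero hω hgr hdv x⟩
    simpa using (hχ ω 0 0).symm
  · have hK : ∑ k, ∫⁻ q, ‖g k q‖ₑ ^ 2 ∂edgeMeasure P ≠ ∞ :=
      ENNReal.sum_ne_top.2 fun k _ => (hgfin k).ne
    refine ⟨_, fun x y hxy =>
      (integral_cond_le hα.ne' hK ?_).trans_lt (lt_add_one _)⟩
    have hind (ω) : ‖Set.indicator {ω' : Env d | x ∈ Cinf d ω'} (fun _ => (1 : ℝ)) ω‖ₑ ≤ 1 := by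
      by_cases h : ω ∈ {ω' : Env d | x ∈ Cinf d ω'} <;> simp [h]
    have hdrop : ∫⁻ ω, ‖‖χ ω y - χ ω x‖ ^ 2 * condOf d ω x y *
        Set.indicator {ω' : Env d | x ∈ Cinf d ω'} (fun _ => (1 : ℝ)) ω‖ₑ ∂P ≤
        ∫⁻ ω, ‖χ ω y - χ ω x‖ₑ ^ 2 * ‖condOf d ω x y‖ₑ ∂P := by
      refine lintegral_mono fun ω => ?_
      rw [enorm_mul, enorm_mul, enorm_pow, enorm_norm]
      exact mul_le_of_le_one_right' (hind ω)
    refine hdrop.trans ?_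
    rcases hxy with ⟨i, rfl⟩ | ⟨i, rfl⟩
    · simp only [condOf_add_unitE]
      exact lintegral_increment_le hshift hmem hg hgrad x i
    · simp only [condOf_add_unitE_left, ← enorm_neg (χ _ y - _), neg_sub]
      exact lintegral_increment_le hshift hmem hg hgrad y i

end RCRW
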